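/- Let p ≥ 3, λ > 0, δ ∈ (0,1), let n ≥ 2 be even, and suppose μ_o ∈ ℝᵖ with μ_o ≥ 0 coordinatewise satisfies R(μ_o) ≤ ε_o. Draw S ~ Dⁿ i.i.d. and let μ̂ be any minimizer of (λ/2)‖μ‖₁ + R̂_S(μ) over {μ ≥ 0}. Then with probability at least 1 − 2δ, R(μ̂) ≤ ε_o + (λ/2)‖μ_o‖₁ + 2‖μ_o‖₁‖κ‖_∞√(2 log p/n) + (1 + ‖μ_o‖₁‖κ‖_∞)√(2 log(1/δ)/n) + (4‖κ‖_∞/λ)√(2 log p/n) + (1 + 2‖κ‖_∞/λ)√(2 log(1/δ)/n). -/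

import Mathlib

open MeasureTheory Finset

noncomputable section

/-- The ±1 real value of a Boolean label: `true ↦ 1`, `false ↦ -1`.
We encode the label space {−1, 1} by `Bool`. -/
def sgn (b : Bool) : ℝ := if b then 1 else -1

/-- The Euclidean (L2) norm on ℝᵖ. -/
def l2norm {p : ℕ} (μ : Fin p → ℝ) : ℝ := Real.sqrt (∑ i, μ i ^ 2)

/-- The L1 norm on ℝᵖ. -/
def l1norm {p : ℕ} (μ : Fin p → ℝ) : ℝ := ∑ i, |μ i|

/-- The L∞ (supremum) norm on ℝᵖ. -/
def linfnorm {p : ℕ} (μ : Fin p → ℝ) : ℝ := ⨆ i, |μ i|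

/-- The standard inner product on ℝᵖ. -/
def ip {p : ℕ} (μ v : Fin p → ℝ) : ℝ := ∑ i, μ i * v i

/-- The K-space feature map `z(x,x') = (K₁(x,x'),…,K_p(x,x'))`. -/
def zmap {X : Type*} {p : ℕ} (K : Fin p → X → X → ℝ) (x x' : X) : Fin p → ℝ :=
  fun i => K i x x'

/-- The pairwise hinge loss `ℓ(μ, (x,y), (x',y')) = max(0, 1 − y y' ⟨μ, z(x,x')⟩)`. -/
def hinge {X : Type*} {p : ℕ} (K : Fin p → X → X → ℝ) (μ : Fin p → ℝ)
    (w w' : X × Bool) : ℝ :=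
  max 0 (1 - sgn w.2 * sgn w'.2 * ip μ (zmap K w.1 w'.1))

/-- The empirical risk `R̂_S(μ) = (2/(n(n−1))) Σ_{1≤i<j≤n} ℓ(μ, (xᵢ,yᵢ), (xⱼ,yⱼ))`. -/
def empRisk {X : Type*} {p n : ℕ} (K : Fin p → X → X → ℝ)
    (S : Fin n → X × Bool) (μ : Fin p → ℝ) : ℝ :=
  (2 / ((n : ℝ) * ((n : ℝ) - 1))) *
    ∑ i : Fin n, ∑ j : Fin n, if i < j then hinge K μ (S i) (S j) else 0

/-- The true risk `R(μ) = E_{((x,y),(x',y')) ~ D×D}[max(0, 1 − y y' ⟨μ, z(x,x')⟩)]`. -/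
def trueRisk {X : Type*} [MeasurableSpace X] {p : ℕ} (K : Fin p → X → X → ℝ)
    (D : Measure (X × Bool)) (μ : Fin p → ℝ) : ℝ :=
  ∫ w, hinge K μ w.1 w.2 ∂(D.prod D)

/-- Expectation over m i.i.d. Rademacher random variables (uniform on {−1,+1}),
encoded by Booleans mapped to ±1 via `sgn`. -/
def radE {m : ℕ} (f : (Fin m → Bool) → ℝ) : ℝ :=
  (∑ ε : Fin m → Bool, f ε) / 2 ^ m


open ProbabilityTheory

lemma abs_sgn (b : Bool) : |sgn b| = 1 := by cases b <;> simp [sgn]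

lemma sgn_not (b : Bool) : sgn (!b) = -sgn b := by cases b <;> simp [sgn]

lemma finite_le_ciSup {Θ : Type*} [Finite Θ] (f : Θ → ℝ) (θ : Θ) : f θ ≤ ⨆ θ, f θ :=
  le_ciSup (Set.finite_range f).bddAbove θ

lemma iSup_add_iSup_sub_le {Θ : Type*} [Finite Θ] [Nonempty Θ] (r φ ψ : Θ → ℝ)
    (hφ : ∀ a b, |φ a - φ b| ≤ |ψ a - ψ b|) :
    (⨆ θ, (r θ + φ θ)) + (⨆ θ, (r θ - φ θ)) ≤ (⨆ θ, (r θ + ψ θ)) + (⨆ θ, (r θ - ψ θ)) := by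
  obtain ⟨a, ha⟩ := exists_eq_ciSup_of_finite (f := fun θ => r θ + φ θ)
  obtain ⟨b, hb⟩ := exists_eq_ciSup_of_finite (f := fun θ => r θ - φ θ)
  have h1 := finite_le_ciSup (fun θ => r θ + ψ θ)
  have h2 := finite_le_ciSup (fun θ => r θ - ψ θ)
  have h := (le_abs_self _).trans (hφ a b)
  rw [← ha, ← hb]
  rcases abs_cases (ψ a - ψ b) with ⟨h', _⟩ | ⟨h', _⟩
  · linarith [h1 a, h2 b]
  · linarith [h1 b, h2 a]

lemma sum_bool_fin_succ {N : ℕ} (F : (Fin (N + 1) → Bool) → ℝ) :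
    ∑ σ, F σ = ∑ σ : Fin N → Bool, (F (Fin.cons true σ) + F (Fin.cons false σ)) := by
  rw [← (Fin.consEquiv fun _ => Bool).sum_comp, Fintype.sum_prod_type, Fintype.sum_bool,
    ← sum_add_distrib]
  rfl

/-- Talagrand's contraction principle for a finite index set. -/
lemma rademacher_contraction {Θ : Type*} [Finite Θ] [Nonempty Θ] {N : ℕ} (h : Θ → ℝ)
    (φ ψ : Fin N → Θ → ℝ) (hφ : ∀ i a b, |φ i a - φ i b| ≤ |ψ i a - ψ i b|) :
    ∑ σ : Fin N → Bool, ⨆ θ, (h θ + ∑ i, sgn (σ i) * φ i θ) ≤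
      ∑ σ : Fin N → Bool, ⨆ θ, (h θ + ∑ i, sgn (σ i) * ψ i θ) := by
  induction N generalizing h with
  | zero => simp
  | succ N ih =>
    have key := fun h' : Θ → ℝ =>
      ih h' (fun i => φ i.succ) (fun i => ψ i.succ) (fun i => hφ i.succ)
    have e (g : Fin (N + 1) → Θ → ℝ) (σ : Fin N → Bool) (b : Bool) (θ : Θ) :
        h θ + ∑ i, sgn ((Fin.cons b σ : Fin (N + 1) → Bool) i) * g i θ =
          (h θ + sgn b * g 0 θ) + ∑ i, sgn (σ i) * g i.succ θ := by
      rw [Fin.sum_univ_succ]; simp [add_assoc]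
    rw [sum_bool_fin_succ, sum_bool_fin_succ]
    simp only [e]
    calc _ ≤ ∑ σ : Fin N → Bool,
          ((⨆ θ, ((h θ + sgn true * ψ 0 θ) + ∑ i, sgn (σ i) * φ i.succ θ)) +
            ⨆ θ, ((h θ + sgn false * ψ 0 θ) + ∑ i, sgn (σ i) * φ i.succ θ)) := by
          refine sum_le_sum fun σ _ => ?_
          have := iSup_add_iSup_sub_le (fun θ => h θ + ∑ i, sgn (σ i) * φ i.succ θ) _ _ (hφ 0)
          convert this using 3 <;> (ext θ; simp [sgn] <;> ring)
      _ ≤ _ := by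
          rw [sum_add_distrib, sum_add_distrib]
          exact add_le_add (key _) (key _)

lemma sum_sq_sgn (N : ℕ) :
    ∑ σ : Fin N → Bool, (∑ i, sgn (σ i)) ^ 2 = 2 ^ N * (N : ℝ) := by
  induction N with
  | zero => simp
  | succ N ih =>
    rw [sum_bool_fin_succ]
    have (σ : Fin N → Bool) :
        (∑ i, sgn ((Fin.cons true σ : Fin (N + 1) → Bool) i)) ^ 2 +
          (∑ i, sgn ((Fin.cons false σ : Fin (N + 1) → Bool) i)) ^ 2 =
          2 * (∑ i, sgn (σ i)) ^ 2 + 2 := by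
      rw [Fin.sum_univ_succ, Fin.sum_univ_succ]; simp [sgn]; ring
    simp only [this, sum_add_distrib, ← mul_sum, ih]
    simp; ring

lemma sum_abs_sgn_le (N : ℕ) :
    ∑ σ : Fin N → Bool, |∑ i, sgn (σ i)| ≤ 2 ^ N * √(N : ℝ) := by
  apply le_of_sq_le_sq _ (by positivity)
  have := sq_sum_le_card_mul_sum_sq (s := univ) (f := fun σ : Fin N → Bool => |∑ i, sgn (σ i)|)
  simp only [sq_abs, sum_sq_sgn] at this
  rw [mul_pow, Real.sq_sqrt (by positivity)]
  calc _ ≤ _ := this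
    _ = _ := by simp; ring

lemma sum_sgn_neg {N : ℕ} (F : (Fin N → Bool) → ℝ) :
    ∑ σ : Fin N → Bool, F (fun i => !σ i) = ∑ σ, F σ :=
  (Equiv.arrowCongr (Equiv.refl (Fin N)) Equiv.boolNot).sum_comp F

lemma sum_exp_rademacher_le {N : ℕ} (v : Fin N → ℝ) (c : ℝ) (hv : ∀ i, |v i| ≤ c) (s : ℝ) :
    ∑ σ : Fin N → Bool, Real.exp (s * ∑ i, sgn (σ i) * v i) ≤
      2 ^ N * Real.exp (N * (s * c) ^ 2 / 2) := by
  have h1 (σ : Fin N → Bool) : Real.exp (s * ∑ i, sgn (σ i) * v i) =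
      ∏ i, Real.exp (sgn (σ i) * (s * v i)) := by
    rw [← Real.exp_sum, mul_sum]
    congr 1; exact sum_congr rfl fun i _ => by ring
  simp only [h1]
  rw [← Fintype.piFinset_univ,
    ← prod_univ_sum (fun _ : Fin N => (univ : Finset Bool)) (fun i b => Real.exp (sgn b * (s * v i)))]
  have h2 (i : Fin N) : ∑ b : Bool, Real.exp (sgn b * (s * v i)) ≤
      2 * Real.exp ((s * c) ^ 2 / 2) := by
    have h3 := Real.cosh_le_exp_half_sq (s * v i)
    have h4 : (s * v i) ^ 2 ≤ (s * c) ^ 2 := by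
      rw [mul_pow, mul_pow, ← sq_abs (v i)]
      have := hv i
      gcongr
    have h5 : Real.exp ((s * v i) ^ 2 / 2) ≤ Real.exp ((s * c) ^ 2 / 2) := by gcongr
    rw [Real.cosh_eq] at h3
    simp [sgn]
    linarith
  calc _ ≤ ∏ i : Fin N, (2 * Real.exp ((s * c) ^ 2 / 2)) :=
        prod_le_prod (fun i _ => sum_nonneg fun b _ => (Real.exp_pos _).le) fun i _ => h2 i
    _ = _ := by
        rw [prod_const, mul_pow, ← Real.exp_nat_mul]; simp; ring_nf

lemma sum_exp_pos_part_rademacher_le {N : ℕ} (v : Fin N → ℝ) (c : ℝ) (hv : ∀ i, |v i| ≤ c)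
    (s : ℝ) :
    ∑ σ : Fin N → Bool, (Real.exp (max 0 (s * ∑ i, sgn (σ i) * v i)) - 1) ≤
      2 ^ N * (Real.exp (N * (s * c) ^ 2 / 2) - 1 / 2) := by
  have h := sum_exp_rademacher_le v c hv s
  have h1 := sum_sgn_neg fun σ : Fin N → Bool =>
    (Real.exp (max 0 (s * ∑ i, sgn (σ i) * v i)) - 1)
  have h2 := sum_sgn_neg fun σ : Fin N → Bool => Real.exp (s * ∑ i, sgn (σ i) * v i)
  have h3 (σ : Fin N → Bool) : s * ∑ i, sgn (!σ i) * v i = -(s * ∑ i, sgn (σ i) * v i) := by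
    simp [sgn_not]
  simp only [h3] at h1 h2
  have h4 (x : ℝ) : (Real.exp (max 0 (-x)) - 1) + (Real.exp (max 0 x) - 1) ≤
      Real.exp (-x) + Real.exp x - 1 := by
    rcases le_total 0 x with hx | hx
    · rw [max_eq_left (by linarith), max_eq_right hx]
      simp only [Real.exp_zero]; linarith [Real.exp_pos (-x)]
    · rw [max_eq_right (by linarith), max_eq_left hx]
      simp only [Real.exp_zero]; linarith [Real.exp_pos x]
  have h5 := sum_le_sum fun (σ : Fin N → Bool) (_ : σ ∈ univ) => h4 (s * ∑ i, sgn (σ i) * v i)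
  simp only [sum_sub_distrib] at h1
  simp only [sum_sub_distrib, sum_add_distrib, h2] at h5
  simp at h1 h5 ⊢
  linarith

/-- Massart's finite class lemma, including the zero element at no extra cost. -/
lemma rademacher_max_le {N p : ℕ} (hp : 3 ≤ p) (hN : 0 < N) (v : Fin N → Fin p → ℝ) (c : ℝ)
    (hc : 0 < c) (hv : ∀ i j, |v i j| ≤ c) :
    ∑ σ : Fin N → Bool, max 0 (⨆ j, ∑ i, sgn (σ i) * v i j) ≤
      2 ^ N * (c * √(2 * N * Real.log p)) := by
  have hN' : (0 : ℝ) < N := by exact_mod_cast hN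
  have hp' : (3 : ℝ) ≤ p := by exact_mod_cast hp
  have hlog : 0 < Real.log p := Real.log_pos (by linarith)
  have : Nonempty (Fin p) := ⟨⟨0, by omega⟩⟩
  set L := √(2 * N * Real.log p) with hL
  have hLpos : 0 < L := by positivity
  have hL2 : L ^ 2 = 2 * N * Real.log p := Real.sq_sqrt (by positivity)
  set s := L / (N * c) with hs
  have hspos : 0 < s := by positivity
  have hsc : N * (s * c) ^ 2 / 2 = Real.log p := by
    rw [hs]; field_simp; linarith
  set Z : (Fin N → Bool) → ℝ := fun σ => max 0 (⨆ j, ∑ i, sgn (σ i) * v i j) with hZ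
  have hjensen : Real.exp (s * ((∑ σ, Z σ) / 2 ^ N)) ≤ (∑ σ, Real.exp (s * Z σ)) / 2 ^ N := by
    have := convexOn_exp.map_sum_le (t := univ) (w := fun _ : Fin N → Bool => ((2 : ℝ) ^ N)⁻¹)
      (p := fun σ => s * Z σ) (fun _ _ => by positivity) (by simp) (by simp)
    simp only [smul_eq_mul, ← mul_sum] at this
    calc _ = _ := by congr 1; ring
      _ ≤ _ := this
      _ = _ := by ring
  have hpt (σ : Fin N → Bool) : Real.exp (s * Z σ) ≤
      1 + ∑ j, (Real.exp (max 0 (s * ∑ i, sgn (σ i) * v i j)) - 1) := by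
    have hnn (j : Fin p) : 0 ≤ Real.exp (max 0 (s * ∑ i, sgn (σ i) * v i j)) - 1 := by
      have := Real.one_le_exp (le_max_left 0 (s * ∑ i, sgn (σ i) * v i j)); linarith
    obtain ⟨j, hj⟩ := exists_eq_ciSup_of_finite (f := fun j => ∑ i, sgn (σ i) * v i j)
    have := single_le_sum (fun j _ => hnn j) (mem_univ j)
    have e : s * Z σ = max 0 (s * ∑ i, sgn (σ i) * v i j) := by
      simp only [hZ, ← hj]; rw [mul_max_of_nonneg _ _ hspos.le, mul_zero]
    rw [e]; linarith
  have hsum : ∑ σ, Real.exp (s * Z σ) ≤ 2 ^ N * (p * p) := by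
    calc _ ≤ _ := sum_le_sum fun σ _ => hpt σ
      _ = 2 ^ N + ∑ j, ∑ σ : Fin N → Bool,
          (Real.exp (max 0 (s * ∑ i, sgn (σ i) * v i j)) - 1) := by
        rw [sum_add_distrib, sum_comm]; simp
      _ ≤ 2 ^ N + ∑ j : Fin p, 2 ^ N * ((p : ℝ) - 1 / 2) := by
        gcongr with j
        have := sum_exp_pos_part_rademacher_le (fun i => v i j) c (fun i => hv i j) s
        rwa [hsc, Real.exp_log (by linarith)] at this
      _ ≤ _ := by
        simp
        have : (0 : ℝ) < 2 ^ N := by positivity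
        nlinarith
  have h1 : Real.exp (s * ((∑ σ, Z σ) / 2 ^ N)) ≤ p * p := by
    refine hjensen.trans ?_
    rw [div_le_iff₀ (by positivity)]; linarith
  have h2 : s * ((∑ σ, Z σ) / 2 ^ N) ≤ 2 * Real.log p := by
    rw [← Real.exp_le_exp]
    refine h1.trans_eq ?_
    rw [two_mul, Real.exp_add, Real.exp_log (by linarith)]
  have h3 : (∑ σ, Z σ) / 2 ^ N ≤ c * L := by
    have : s * (c * L) = 2 * Real.log p := by
      rw [hs]; field_simp; linarith
    exact le_of_mul_le_mul_left (h2.trans_eq this.symm) hspos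
  rw [div_le_iff₀ (by positivity)] at h3
  linarith

/-- Rademacher complexity of the hinge loss over nonnegative vectors of bounded ℓ¹ norm. -/
lemma hinge_rademacher_le {Θ : Type*} [Finite Θ] [Nonempty Θ] {N p : ℕ} (hp : 3 ≤ p)
    (hN : 0 < N) (v : Fin N → Fin p → ℝ) (c : ℝ) (hc : 0 < c) (hv : ∀ i j, |v i j| ≤ c)
    (μ : Θ → Fin p → ℝ) (hμ : ∀ θ j, 0 ≤ μ θ j) (B : ℝ) (hB : ∀ θ, ∑ j, μ θ j ≤ B) :
    ∑ σ : Fin N → Bool, ⨆ θ, ∑ i, sgn (σ i) * max 0 (1 - ip (μ θ) (v i)) ≤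
      2 ^ N * (B * (c * √(2 * N * Real.log p))) := by
  have hB0 : 0 ≤ B := (sum_nonneg fun j _ => hμ (Classical.arbitrary Θ) j).trans (hB _)
  have h1 := rademacher_contraction (fun _ : Θ => 0) (fun i θ => max 0 (1 - ip (μ θ) (v i)))
    (fun i θ => ip (μ θ) (v i)) fun i a b => by
      have := abs_max_sub_max_le_abs (1 - ip (μ a) (v i)) (1 - ip (μ b) (v i)) 0
      rw [max_comm, max_comm _ (0 : ℝ), sub_sub_sub_cancel_left, abs_sub_comm (ip (μ b) _)] at this
      exact this
  simp only [zero_add] at h1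
  refine h1.trans ?_
  calc _ ≤ ∑ σ : Fin N → Bool, B * max 0 (⨆ j, ∑ i, sgn (σ i) * v i j) := by
        refine sum_le_sum fun σ _ => ciSup_le fun θ => ?_
        set Z := max 0 (⨆ j, ∑ i, sgn (σ i) * v i j)
        calc ∑ i, sgn (σ i) * ip (μ θ) (v i) = ∑ j, μ θ j * ∑ i, sgn (σ i) * v i j := by
              simp only [ip, mul_sum]
              rw [sum_comm]
              exact sum_congr rfl fun j _ => sum_congr rfl fun i _ => by ring
          _ ≤ ∑ j, μ θ j * Z := by
              refine sum_le_sum fun j _ => mul_le_mul_of_nonneg_left ?_ (hμ θ j)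
              exact (finite_le_ciSup (fun j => ∑ i, sgn (σ i) * v i j) j).trans (le_max_right _ _)
          _ ≤ B * Z := by
              rw [← sum_mul]
              exact mul_le_mul_of_nonneg_right (hB θ) (le_max_left _ _)
    _ ≤ _ := by
        rw [← mul_sum]
        have := mul_le_mul_of_nonneg_left (rademacher_max_le hp hN v c hc hv) hB0
        linarith

lemma measurePreserving_comp_injective {Ω ι ι' : Type*} [MeasurableSpace Ω] [Fintype ι]
    [Fintype ι'] (D : Measure Ω) [IsProbabilityMeasure D] {g : ι → ι'} (hg : g.Injective) :
    MeasurePreserving (fun (X : ι' → Ω) a => X (g a)) (Measure.pi fun _ => D)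
      (Measure.pi fun _ => D) := by
  refine ⟨by fun_prop, ?_⟩
  have h := (iIndepFun_pi (μ := fun _ : ι' => D) (X := fun _ x => x)
    fun _ => aemeasurable_id).precomp hg
  rw [iIndepFun_iff_map_fun_eq_pi_map fun i => (measurable_pi_apply (g i)).aemeasurable] at h
  rw [h]
  congr 1; ext1 a
  exact (measurePreserving_eval (fun _ : ι' => D) (g a)).map_eq

lemma measurePreserving_pairs {Ω ι ι' : Type*} [MeasurableSpace Ω] [Fintype ι] [Fintype ι']
    (D : Measure Ω) [IsProbabilityMeasure D] (τ : ι × Bool ≃ ι') :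
    MeasurePreserving (fun (S : ι' → Ω) a => (S (τ (a, false)), S (τ (a, true))))
      (Measure.pi fun _ => D) (Measure.pi fun _ : ι => D.prod D) := by
  refine ⟨by fun_prop, Eq.symm ?_⟩
  refine Measure.pi_eq_generateFrom
    (C := fun _ => Set.image2 (· ×ˢ ·) {s : Set Ω | MeasurableSet s} {s | MeasurableSet s})
    (fun _ => generateFrom_prod) (fun _ => isPiSystem_prod)
    (fun _ => D.toFiniteSpanningSetsIn.prod D.toFiniteSpanningSetsIn) ?_
  intro s hs
  choose s₁ h₁ s₂ h₂ h using hs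
  have hm : MeasurableSet (Set.univ.pi s) := MeasurableSet.univ_pi fun a => by
    rw [← h a]; exact (h₁ a).prod (h₂ a)
  rw [Measure.map_apply (by fun_prop) hm]
  have : (fun (S : ι' → Ω) a => (S (τ (a, false)), S (τ (a, true)))) ⁻¹' (Set.univ.pi s) =
      Set.univ.pi fun i => if (τ.symm i).2 then s₂ (τ.symm i).1 else s₁ (τ.symm i).1 := by
    ext S
    simp only [Set.mem_preimage, Set.mem_univ_pi, ← h]
    rw [← τ.forall_congr_right, Prod.forall]
    simp
  rw [this, Measure.pi_pi, ← τ.prod_comp, Fintype.prod_prod_type]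
  refine prod_congr rfl fun a _ => ?_
  rw [← h a]
  simp [Measure.prod_prod, mul_comm]

lemma integrable_of_bounded {Ω : Type*} [MeasurableSpace Ω] {P : Measure Ω} [IsFiniteMeasure P]
    {F : Ω → ℝ} (hF : Measurable F) (hb : ∃ C, ∀ x, |F x| ≤ C) : Integrable F P := by
  obtain ⟨C, hC⟩ := hb
  exact Integrable.of_bound hF.aestronglyMeasurable C (ae_of_all _ hC)

lemma integrable_exp_of_bounded {Ω : Type*} [MeasurableSpace Ω] {P : Measure Ω}
    [IsFiniteMeasure P] {F : Ω → ℝ} (hF : Measurable F) (hb : ∃ C, ∀ x, |F x| ≤ C) :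
    Integrable (fun x => Real.exp (F x)) P := by
  obtain ⟨C, hC⟩ := hb
  refine integrable_of_bounded hF.exp ⟨Real.exp C, fun x => ?_⟩
  rw [abs_of_pos (Real.exp_pos _)]
  exact Real.exp_le_exp.2 ((le_abs_self _).trans (hC x))

lemma integral_exp_le_of_range {Ω : Type*} [MeasurableSpace Ω] {P : Measure Ω}
    [IsProbabilityMeasure P] {Y : Ω → ℝ} (hY : Measurable Y) {c : ℝ}
    (hc : ∀ x y, Y x ≤ Y y + c) :
    ∫ x, Real.exp (Y x) ∂P ≤ Real.exp (∫ x, Y x ∂P + c ^ 2 / 8) := by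
  have : Nonempty Ω := P.nonempty_of_neZero
  have hbdd : BddBelow (Set.range Y) :=
    ⟨Y (Classical.arbitrary Ω) - c, by rintro _ ⟨y, rfl⟩; linarith [hc (Classical.arbitrary Ω) y]⟩
  have hmem : ∀ᵐ x ∂P, Y x ∈ Set.Icc (⨅ x, Y x) ((⨅ x, Y x) + c) := by
    refine ae_of_all _ fun x => ⟨ciInf_le hbdd x, ?_⟩
    have : Y x - c ≤ ⨅ x, Y x := le_ciInf fun y => by linarith [hc x y]
    linarith
  have h := (hasSubgaussianMGF_of_mem_Icc hY.aemeasurable hmem).mgf_le 1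
  simp only [mgf, one_mul, Real.exp_sub, integral_div] at h
  rw [div_le_iff₀ (Real.exp_pos _), ← Real.exp_add] at h
  refine h.trans_eq ?_
  congr 1
  simp [div_pow]
  ring

lemma integral_pi_fin_succ {Ω : Type*} [MeasurableSpace Ω] (P : Measure Ω)
    [IsProbabilityMeasure P] {N : ℕ} {F : (Fin (N + 1) → Ω) → ℝ} (hF : Measurable F)
    (hb : ∃ C, ∀ x, |F x| ≤ C) :
    ∫ X, F X ∂(Measure.pi fun _ => P) =
      ∫ X, ∫ x, F (Fin.cons x X) ∂P ∂(Measure.pi fun _ : Fin N => P) := by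
  have h := (measurePreserving_piFinSuccAbove (fun _ : Fin (N + 1) => P) 0).symm
  rw [← h.integral_comp', integral_prod_symm]
  · simp [MeasurableEquiv.piFinSuccAbove, Fin.insertNthEquiv]
  · obtain ⟨C, hC⟩ := hb
    exact integrable_of_bounded (hF.comp (MeasurableEquiv.measurable _)) ⟨C, fun x => hC _⟩

lemma measurable_fin_cons {Ω : Type*} [MeasurableSpace Ω] {N : ℕ} :
    Measurable fun z : (Fin N → Ω) × Ω => (Fin.cons z.2 z.1 : Fin (N + 1) → Ω) := by
  refine measurable_pi_lambda _ fun i => ?_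
  refine Fin.cases ?_ (fun j => ?_) i
  · simpa using measurable_snd
  · simpa [Function.comp_def] using (measurable_pi_apply j).comp measurable_fst

/-- Moment generating function form of McDiarmid's bounded differences inequality. -/
lemma integral_exp_le_of_bounded_differences {Ω : Type*} [MeasurableSpace Ω] (P : Measure Ω)
    [IsProbabilityMeasure P] {N : ℕ} {F : (Fin N → Ω) → ℝ} (hF : Measurable F)
    (hb : ∃ C, ∀ x, |F x| ≤ C) {c : ℝ}
    (hc : ∀ X i x, F X ≤ F (Function.update X i x) + c) :
    ∫ X, Real.exp (F X) ∂(Measure.pi fun _ => P) ≤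
      Real.exp (∫ X, F X ∂(Measure.pi fun _ => P) + N * (c ^ 2 / 8)) := by
  induction N with
  | zero =>
    have h (X : Fin 0 → Ω) : F X = F default := congrArg F (Subsingleton.elim _ _)
    simp [h]
  | succ N ih =>
    obtain ⟨C, hC⟩ := hb
    have hexpb : ∃ C', ∀ X, |Real.exp (F X)| ≤ C' := ⟨Real.exp C, fun X => by
      rw [abs_of_pos (Real.exp_pos _)]
      exact Real.exp_le_exp.2 ((le_abs_self _).trans (hC X))⟩
    have hFc : Measurable (Function.uncurry fun (X : Fin N → Ω) (x : Ω) => F (Fin.cons x X)) :=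
      hF.comp measurable_fin_cons
    have hx (X : Fin N → Ω) : Measurable fun x => F (Fin.cons x X) :=
      hFc.comp (measurable_const.prodMk measurable_id)
    set G : (Fin N → Ω) → ℝ := fun X => ∫ x, F (Fin.cons x X) ∂P with hG
    have hGm : Measurable G := hFc.stronglyMeasurable.integral_prod_right.measurable
    have hGb : ∀ X, |G X| ≤ C := fun X => by
      have := norm_integral_le_of_norm_le_const (μ := P)
        (f := fun x => F (Fin.cons x X)) (ae_of_all _ fun x => hC (Fin.cons x X))
      simpa using this
    have hint (X : Fin N → Ω) : Integrable (fun x => F (Fin.cons x X)) P :=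
      integrable_of_bounded (hx X) ⟨C, fun x => hC _⟩
    have hGc (X : Fin N → Ω) (i : Fin N) (y : Ω) : G X ≤ G (Function.update X i y) + c := by
      have : G (Function.update X i y) + c =
          ∫ x, (F (Fin.cons x (Function.update X i y)) + c) ∂P := by
        rw [integral_add (hint _) (integrable_const _)]; simp [hG]
      rw [this]
      refine integral_mono (hint _) ((hint _).add (integrable_const _)) fun x => ?_
      have := hc (Fin.cons x X) i.succ y
      rwa [← Fin.cons_update] at this
    have hslice (X : Fin N → Ω) :
        ∫ x, Real.exp (F (Fin.cons x X)) ∂P ≤ Real.exp (G X + c ^ 2 / 8) :=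
      integral_exp_le_of_range (hx X) fun x y => by
        have := hc (Fin.cons x X) 0 y
        rwa [Fin.update_cons_zero] at this
    rw [integral_pi_fin_succ P hF.exp hexpb, integral_pi_fin_succ P hF ⟨C, hC⟩]
    calc _ ≤ ∫ X, Real.exp (G X + c ^ 2 / 8) ∂(Measure.pi fun _ : Fin N => P) := by
          refine integral_mono_of_nonneg (ae_of_all _ fun X => integral_nonneg fun x =>
            (Real.exp_pos _).le) ?_ (ae_of_all _ hslice)
          exact integrable_exp_of_bounded (hGm.add_const _) ⟨C + |c ^ 2 / 8|, fun X =>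
            (abs_add_le _ _).trans (by linarith [hGb X])⟩
      _ = Real.exp (c ^ 2 / 8) * ∫ X, Real.exp (G X) ∂(Measure.pi fun _ : Fin N => P) := by
          simp only [Real.exp_add]; rw [integral_mul_const, mul_comm]
      _ ≤ Real.exp (c ^ 2 / 8) * Real.exp (∫ X, G X ∂(Measure.pi fun _ : Fin N => P) +
            N * (c ^ 2 / 8)) := by
          gcongr
          exact ih hGm ⟨C, hGb⟩ hGc
      _ = _ := by
          rw [← Real.exp_add]; congr 1; push_cast; ring

lemma integral_comp_of_measurePreserving {Ω Ω' : Type*} [MeasurableSpace Ω] [MeasurableSpace Ω']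
    {P : Measure Ω} {P' : Measure Ω'} {g : Ω → Ω'} (hg : MeasurePreserving g P P') {F : Ω' → ℝ}
    (hF : Measurable F) : ∫ x, F (g x) ∂P = ∫ y, F y ∂P' := by
  rw [← hg.map_eq, integral_map hg.measurable.aemeasurable hF.aestronglyMeasurable]

lemma abs_iSup_le_of_finite {Θ : Type*} [Finite Θ] [Nonempty Θ] {h : Θ → ℝ} {C : ℝ}
    (hC : ∀ θ, |h θ| ≤ C) : |⨆ θ, h θ| ≤ C := by
  obtain ⟨a, ha⟩ := exists_eq_ciSup_of_finite (f := h)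
  rw [← ha]; exact hC a

lemma iSup_integral_le {Ω Θ : Type*} [MeasurableSpace Ω] {P : Measure Ω} [IsProbabilityMeasure P]
    [Finite Θ] [Nonempty Θ] {h : Θ → Ω → ℝ} (hm : ∀ θ, Measurable (h θ))
    (hb : ∃ C, ∀ θ x, |h θ x| ≤ C) : ⨆ θ, ∫ x, h θ x ∂P ≤ ∫ x, ⨆ θ, h θ x ∂P := by
  obtain ⟨C, hC⟩ := hb
  refine ciSup_le fun θ => integral_mono (integrable_of_bounded (hm θ) ⟨C, hC θ⟩)
    (integrable_of_bounded (Measurable.iSup hm) ⟨C, fun x => abs_iSup_le_of_finite (hC · x)⟩)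
    fun x => finite_le_ciSup (h · x) θ

lemma measurePreserving_mix {Ω ι : Type*} [MeasurableSpace Ω] [Fintype ι] (Q : Measure Ω)
    [IsProbabilityMeasure Q] (σ : ι → Bool) :
    MeasurePreserving (fun (z : (ι → Ω) × (ι → Ω)) i => if σ i then z.2 i else z.1 i)
      ((Measure.pi fun _ => Q).prod (Measure.pi fun _ => Q)) (Measure.pi fun _ => Q) := by
  have hg : Function.Injective fun i : ι => if σ i then (Sum.inr i : ι ⊕ ι) else Sum.inl i := by
    intro i j hij
    dsimp only at hij
    split_ifs at hij <;> simpa using hij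
  have h := (measurePreserving_comp_injective Q hg).comp
    (measurePreserving_sumPiEquivProdPi_symm (fun _ : ι ⊕ ι => Q))
  convert h using 1
  ext z i
  by_cases hi : σ i <;> simp [hi, MeasurableEquiv.sumPiEquivProdPi]

lemma abs_le_of_range {Ω Θ : Type*} {f : Θ → Ω → ℝ} {lo M : ℝ} (hlo : ∀ θ x, lo ≤ f θ x) (hhi : ∀ θ x, f θ x ≤ lo + M) :
    ∀ θ x, |f θ x| ≤ |lo| + |lo + M| := fun θ x => abs_le.2
  ⟨by linarith [hlo θ x, neg_abs_le lo, abs_nonneg (lo + M)],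
    by linarith [hhi θ x, le_abs_self (lo + M), abs_nonneg lo]⟩

section Symmetrization

variable {Ω Θ : Type*} [MeasurableSpace Ω] [Finite Θ]

/-- Expected supremum of the deviations when the sample `I` carries negative signs and the
complementary sample is replaced by its mean. -/
def meanDev (Q : Measure Ω) (f : Θ → Ω → ℝ) {N : ℕ} (I : Finset (Fin N)) : ℝ :=
  ∫ X, ⨆ θ, (((N : ℝ) - #I) * ∫ x, f θ x ∂Q - ∑ i ∈ I, f θ (X i)) ∂(Measure.pi fun _ => Q)

variable (Q : Measure Ω) [IsProbabilityMeasure Q] {f : Θ → Ω → ℝ}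

lemma meanDev_congr (hf : ∀ θ, Measurable (f θ)) {N : ℕ} {I J : Finset (Fin N)}
    (h : #I = #J) : meanDev Q f I = meanDev Q f J := by
  set e := (Finset.equivOfCardEq h).extendSubtype with he
  have hmp := measurePreserving_comp_injective Q e.injective
  have hm : Measurable fun X : Fin N → Ω =>
      ⨆ θ, (((N : ℝ) - #I) * ∫ x, f θ x ∂Q - ∑ i ∈ I, f θ (X i)) := by fun_prop
  rw [meanDev, meanDev, ← integral_comp_of_measurePreserving hmp hm, h]
  congr 1; ext X; congr 1; ext θ; congr 1
  refine (sum_bij (fun i _ => e i) (fun i hi => ?_) (fun _ _ _ _ hij => e.injective hij)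
    (fun j hj => ?_) (fun _ _ => rfl))
  · exact Equiv.extendSubtype_mem _ i hi
  · refine ⟨e.symm j, ?_, by simp⟩
    by_contra hn
    exact Equiv.extendSubtype_not_mem (Finset.equivOfCardEq h) _ hn (by rw [← he]; simpa using hj)

variable [Nonempty Θ]

lemma integrable_iSup_affine (hf : ∀ θ, Measurable (f θ)) {C : ℝ} (hC : ∀ θ x, |f θ x| ≤ C)
    {ι : Type*} [Fintype ι] (I : Finset ι) (h : Θ → ℝ) :
    Integrable (fun X : ι → Ω => ⨆ θ, (h θ - ∑ i ∈ I, f θ (X i))) (Measure.pi fun _ => Q) := by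
  refine integrable_of_bounded (by fun_prop) ⟨(⨆ θ, |h θ|) + #I * C, fun X => ?_⟩
  refine abs_iSup_le_of_finite fun θ => (abs_sub _ _).trans ?_
  refine add_le_add (finite_le_ciSup (fun θ => |h θ|) θ) ((abs_sum_le_sum_abs _ _).trans ?_)
  simpa using sum_le_sum fun i (_ : i ∈ I) => hC θ (X i)

lemma meanDev_le (hf : ∀ θ, Measurable (f θ)) {C : ℝ} (hC : ∀ θ x, |f θ x| ≤ C)
    {N : ℕ} (σ : Fin N → Bool) :
    meanDev Q f {i | σ i = false} ≤
      ∫ X, ⨆ θ, ∑ i, sgn (σ i) * f θ (X i) ∂(Measure.pi fun _ : Fin N => Q) := by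
  set I : Finset (Fin N) := {i | σ i = false} with hI
  have hCb (X : Fin N → Ω) (θ : Θ) : |∑ i, sgn (σ i) * f θ (X i)| ≤ N * C := by
    refine (abs_sum_le_sum_abs _ _).trans ?_
    simpa [abs_mul, abs_sgn] using sum_le_sum fun i (_ : i ∈ univ) => hC θ (X i)
  have hmeas : Measurable fun X : Fin N → Ω => ⨆ θ, ∑ i, sgn (σ i) * f θ (X i) := by fun_prop
  have hmp := measurePreserving_mix Q σ
  have hmixb : ∃ C', ∀ z : (Fin N → Ω) × (Fin N → Ω),
      |⨆ θ, ∑ i, sgn (σ i) * f θ (if σ i then z.2 i else z.1 i)| ≤ C' :=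
    ⟨N * C, fun z => abs_iSup_le_of_finite fun θ =>
      hCb (fun i => if σ i then z.2 i else z.1 i) θ⟩
  have hmixm : Measurable fun z : (Fin N → Ω) × (Fin N → Ω) =>
      ⨆ θ, ∑ i, sgn (σ i) * f θ (if σ i then z.2 i else z.1 i) := hmeas.comp hmp.measurable
  have hint : Integrable (fun z : (Fin N → Ω) × (Fin N → Ω) =>
      ⨆ θ, ∑ i, sgn (σ i) * f θ (if σ i then z.2 i else z.1 i))
      ((Measure.pi fun _ => Q).prod (Measure.pi fun _ => Q)) := integrable_of_bounded hmixm hmixb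
  rw [← integral_comp_of_measurePreserving hmp hmeas, integral_prod _ hint]
  refine integral_mono (integrable_iSup_affine Q hf hC I _) hint.integral_prod_left fun X => ?_
  have hm (θ : Θ) : Measurable fun Y : Fin N → Ω =>
      ∑ i, sgn (σ i) * f θ (if σ i then Y i else X i) := by
    refine Finset.measurable_sum _ fun i _ => ?_
    split_ifs <;> fun_prop
  refine le_trans (le_of_eq ?_) (iSup_integral_le hm ⟨N * C, fun θ Y =>
    hCb (fun i => if σ i then Y i else X i) θ⟩)
  congr 1; ext θ
  have hi (i : Fin N) : ∫ Y, sgn (σ i) * f θ (if σ i then Y i else X i)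
      ∂(Measure.pi fun _ : Fin N => Q) = if σ i = false then -f θ (X i) else ∫ x, f θ x ∂Q := by
    by_cases h : σ i
    · simp only [h, sgn, if_true, one_mul]
      exact integral_comp_of_measurePreserving (measurePreserving_eval (fun _ => Q) i) (hf θ)
    · simp [h, sgn]
  rw [integral_finsetSum]
  · simp only [hi]
    rw [sum_ite, sum_neg_distrib, sum_const, nsmul_eq_mul, ← hI]
    have : #({i | ¬σ i = false} : Finset (Fin N)) = (N : ℝ) - #I := by
      have := card_filter_add_card_filter_not (s := (univ : Finset (Fin N))) (fun i => σ i = false)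
      rw [card_univ, Fintype.card_fin] at this
      have h' := congrArg (Nat.cast : ℕ → ℝ) this
      push_cast at h'
      rw [hI]; linarith
    rw [this]; ring
  · intro i _
    refine integrable_of_bounded ?_ ⟨C, fun Y => ?_⟩
    · split_ifs <;> fun_prop
    · rw [abs_mul, abs_sgn, one_mul]; exact hC _ _

lemma two_mul_meanDev_le (hf : ∀ θ, Measurable (f θ)) {lo M : ℝ} (hlo : ∀ θ x, lo ≤ f θ x)
    (hhi : ∀ θ x, f θ x ≤ lo + M) {N : ℕ} {I W J : Finset (Fin N)} (hIW : I ⊆ W) (hWJ : W ⊆ J)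
    (hcard : #I + #J = 2 * #W) :
    2 * meanDev Q f W - ((#W : ℝ) - #I) * M ≤ meanDev Q f I + meanDev Q f J := by
  have hC := abs_le_of_range hlo hhi
  have hcard' : (#I : ℝ) + #J = 2 * #W := by exact_mod_cast hcard
  unfold meanDev
  rw [← integral_const_mul, ← integral_add (integrable_iSup_affine Q hf hC I _)
    (integrable_iSup_affine Q hf hC J _), sub_le_iff_le_add]
  have hIJ := (integrable_iSup_affine Q hf hC I fun θ => ((N : ℝ) - #I) * ∫ x, f θ x ∂Q).add
    (integrable_iSup_affine Q hf hC J fun θ => ((N : ℝ) - #J) * ∫ x, f θ x ∂Q)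
  refine (integral_mono ((integrable_iSup_affine Q hf hC W _).const_mul 2)
    (hIJ.add (integrable_const (((#W : ℝ) - #I) * M))) fun X => ?_).trans_eq
    ((integral_add hIJ (integrable_const _)).trans (by simp))
  obtain ⟨θ, hθ⟩ := exists_eq_ciSup_of_finite
    (f := fun θ => ((N : ℝ) - #W) * ∫ x, f θ x ∂Q - ∑ i ∈ W, f θ (X i))
  have hI := finite_le_ciSup (fun θ => ((N : ℝ) - #I) * ∫ x, f θ x ∂Q - ∑ i ∈ I, f θ (X i)) θ
  have hJ := finite_le_ciSup (fun θ => ((N : ℝ) - #J) * ∫ x, f θ x ∂Q - ∑ i ∈ J, f θ (X i)) θ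
  have h₁ : ((#W : ℝ) - #I) * lo ≤ ∑ i ∈ W \ I, f θ (X i) := by
    rw [← Nat.cast_sub (card_le_card hIW), ← card_sdiff_of_subset hIW, ← nsmul_eq_mul]
    exact card_nsmul_le_sum _ _ _ fun i _ => hlo θ (X i)
  have h₂ : ∑ i ∈ J \ W, f θ (X i) ≤ ((#J : ℝ) - #W) * (lo + M) := by
    rw [← Nat.cast_sub (card_le_card hWJ), ← card_sdiff_of_subset hWJ, ← nsmul_eq_mul]
    exact sum_le_card_nsmul _ _ _ fun i _ => hhi θ (X i)
  have h₃ := sum_sdiff (f := fun i => f θ (X i)) hIW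
  have h₄ := sum_sdiff (f := fun i => f θ (X i)) hWJ
  have h₅ : ((#J : ℝ) - #W) = #W - #I := by linarith
  dsimp only [Pi.add_apply] at *
  rw [← hθ]
  rw [h₅] at h₂
  have h₆ : ((N : ℝ) - #I) * ∫ x, f θ x ∂Q + ((N : ℝ) - #J) * ∫ x, f θ x ∂Q =
      2 * (((N : ℝ) - #W) * ∫ x, f θ x ∂Q) := by
    rw [← add_mul, ← mul_assoc]; congr 1; linarith
  linarith

lemma two_mul_meanDev_le_compl (hf : ∀ θ, Measurable (f θ)) {lo M : ℝ} (hlo : ∀ θ x, lo ≤ f θ x)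
    (hhi : ∀ θ x, f θ x ≤ lo + M) {m : ℕ} {W : Finset (Fin (m + m))} (hW : #W = m)
    (I : Finset (Fin (m + m))) :
    2 * meanDev Q f W - |(m : ℝ) - #I| * M ≤ meanDev Q f I + meanDev Q f Iᶜ := by
  have key (I : Finset (Fin (m + m))) (hI : #I ≤ m) :
      2 * meanDev Q f W - |(m : ℝ) - #I| * M ≤ meanDev Q f I + meanDev Q f Iᶜ := by
    obtain ⟨W', hIW, hW'⟩ := exists_superset_card_eq hI (by simp)
    obtain ⟨J, hWJ, hJ⟩ := exists_superset_card_eq (s := W') (n := m + m - #I)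
      (by omega) (by simp)
    have h := two_mul_meanDev_le Q hf hlo hhi hIW hWJ (by omega)
    rw [hW'] at h
    rw [meanDev_congr Q hf (hW.trans hW'.symm),
      meanDev_congr Q hf (show #Iᶜ = #J by rw [card_compl, hJ, Fintype.card_fin]),
      abs_of_nonneg (sub_nonneg.2 (by exact_mod_cast hI))]
    exact h
  rcases le_total (#I) m with hI | hI
  · exact key I hI
  · have hc : #Iᶜ + #I = m + m := by simp
    have h := key Iᶜ (by omega)
    have hc' : (#Iᶜ : ℝ) = m + m - #I := by
      rw [eq_sub_iff_add_eq]; exact_mod_cast hc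
    rw [compl_compl, hc', show (m : ℝ) - (m + m - #I) = -(m - #I) by ring, abs_neg] at h
    linarith

lemma sum_sgn_eq {N : ℕ} (σ : Fin N → Bool) :
    ∑ i, sgn (σ i) = N - 2 * #({i | σ i = false} : Finset (Fin N)) := by
  have h (i : Fin N) : sgn (σ i) = 1 - 2 * if σ i = false then 1 else 0 := by
    cases σ i <;> norm_num [sgn]
  simp only [h, sum_sub_distrib, ← mul_sum, sum_boole]
  simp

/-- Symmetrization of a one-sided deviation over `m` points by signs on `2m` points. -/
lemma integral_iSup_dev_le (hf : ∀ θ, Measurable (f θ)) {lo M : ℝ} (hM : 0 ≤ M)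
    (hlo : ∀ θ x, lo ≤ f θ x) (hhi : ∀ θ x, f θ x ≤ lo + M) {m : ℕ} {R : ℝ}
    (hR : ∀ X : Fin (m + m) → Ω,
      ∑ σ : Fin (m + m) → Bool, ⨆ θ, ∑ i, sgn (σ i) * f θ (X i) ≤ 2 ^ (m + m) * R) :
    ∫ X, ⨆ θ, (m * ∫ x, f θ x ∂Q - ∑ a, f θ (X a)) ∂(Measure.pi fun _ : Fin m => Q) ≤
      R + M / 4 * Real.sqrt (m + m) := by
  have hC := abs_le_of_range hlo hhi
  set W : Finset (Fin (m + m)) := univ.map (Fin.castAddEmb m) with hW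
  have hWc : #W = m := by simp [hW]
  have hWd : ∫ X, ⨆ θ, (m * ∫ x, f θ x ∂Q - ∑ a, f θ (X a)) ∂(Measure.pi fun _ : Fin m => Q) =
      meanDev Q f W := by
    have hmp := measurePreserving_comp_injective Q (Fin.castAdd_injective m m)
    rw [← integral_comp_of_measurePreserving hmp (by fun_prop), meanDev, hWc]
    simp [hW, sum_map]
  rw [hWd]
  set a : (Fin (m + m) → Bool) → ℝ := fun σ => ∫ X, ⨆ θ, ∑ i, sgn (σ i) * f θ (X i)
    ∂(Measure.pi fun _ : Fin (m + m) => Q) with ha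
  have hpair (σ : Fin (m + m) → Bool) :
      2 * meanDev Q f W - |∑ i, sgn (σ i)| * (M / 2) ≤ a σ + a fun i => !σ i := by
    have h := two_mul_meanDev_le_compl Q hf hlo hhi hWc {i | σ i = false}
    have h₁ := meanDev_le Q hf hC σ
    have h₂ := meanDev_le Q hf hC fun i => !σ i
    have hcompl : ({i | σ i = false} : Finset (Fin (m + m)))ᶜ =
        ({i | (!σ i) = false} : Finset (Fin (m + m))) := by
      ext i; simp
    rw [hcompl] at h
    rw [sum_sgn_eq, show (((m + m : ℕ) : ℝ) - 2 * #({i | σ i = false} : Finset (Fin (m + m)))) =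
      2 * (m - #({i | σ i = false} : Finset (Fin (m + m)))) by push_cast; ring, abs_mul, abs_two]
    linarith
  have hsum := sum_le_sum fun σ (_ : σ ∈ univ) => hpair σ
  rw [sum_add_distrib, sum_sgn_neg a, sum_sub_distrib, ← sum_mul univ _ (M / 2), sum_const, nsmul_eq_mul,
    card_univ, Fintype.card_fun, Fintype.card_bool, Fintype.card_fin] at hsum
  have hle : ∑ σ, a σ ≤ 2 ^ (m + m) * R := by
    have hi (σ : Fin (m + m) → Bool) : Integrable (fun X : Fin (m + m) → Ω =>
        ⨆ θ, ∑ i, sgn (σ i) * f θ (X i)) (Measure.pi fun _ => Q) := by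
      refine integrable_of_bounded (by fun_prop)
        ⟨∑ _i : Fin (m + m), (|lo| + |lo + M|), fun X => abs_iSup_le_of_finite fun θ => ?_⟩
      refine (abs_sum_le_sum_abs _ _).trans (sum_le_sum fun i _ => ?_)
      rw [abs_mul, abs_sgn, one_mul]; exact hC _ _
    rw [ha, ← integral_finsetSum _ fun σ _ => hi σ]
    refine (integral_mono (integrable_finsetSum _ fun σ _ => hi σ) (integrable_const _)
      hR).trans_eq ?_
    simp
  have habs := mul_le_mul_of_nonneg_right (sum_abs_sgn_le (m + m)) (div_nonneg hM zero_le_two)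
  push_cast at *
  have h2 : (0 : ℝ) < 2 ^ (m + m) := by positivity
  refine le_of_mul_le_mul_left ?_ h2
  linarith

end Symmetrization

/-- The average of a kernel over the increasing pairs of a sample. -/
def uAvg {Ω : Type*} {n : ℕ} (f : Ω × Ω → ℝ) (S : Fin n → Ω) : ℝ :=
  (2 / ((n : ℝ) * ((n : ℝ) - 1))) * ∑ i, ∑ j, if i < j then f (S i, S j) else 0

/-- The pairing `e` moved by a permutation, each pair then being put in increasing order. -/
def orderedPairing {ι : Type*} {n : ℕ} (e : ι × Bool ≃ Fin n) (π : Equiv.Perm (Fin n)) :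
    ι × Bool ≃ Fin n :=
  (Equiv.prodShear (Equiv.refl ι) fun a =>
    if π (e (a, false)) < π (e (a, true)) then Equiv.refl Bool else Equiv.boolNot).trans
      (e.trans π)

lemma exists_perm_apply_eq {α : Type*} [DecidableEq α] {i j i' j' : α} (h : i ≠ j)
    (h' : i' ≠ j') : ∃ ρ : Equiv.Perm α, ρ i = i' ∧ ρ j = j' := by
  refine ⟨Equiv.swap (Equiv.swap i i' j) j' * Equiv.swap i i', ?_, by simp⟩
  have hne : i' ≠ Equiv.swap i i' j := fun hi => h <| (Equiv.swap i i').injective (by simpa using hi)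
  simp [Equiv.swap_apply_of_ne_of_ne hne h']

lemma sum_perm_eq {n : ℕ} (G : Fin n → Fin n → ℝ) {a b : Fin n} (hab : a ≠ b) :
    ((n : ℝ) * (n - 1)) * ∑ π : Equiv.Perm (Fin n), G (π a) (π b) =
      (n.factorial : ℝ) * ∑ i, ∑ j, if i = j then 0 else G i j := by
  have h₁ : ∑ i : Fin n, ∑ j : Fin n, (if i = j then 0 else
      ∑ π : Equiv.Perm (Fin n), G (π i) (π j)) =
      (n.factorial : ℝ) * ∑ i, ∑ j, if i = j then 0 else G i j := by
    have hsw : ∀ i j : Fin n, (if i = j then 0 else ∑ π : Equiv.Perm (Fin n), G (π i) (π j)) =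
        ∑ π : Equiv.Perm (Fin n), if π i = π j then 0 else G (π i) (π j) := fun i j => by
      by_cases h : i = j <;> simp [h]
    simp only [hsw]
    calc _ = ∑ π : Equiv.Perm (Fin n), ∑ i, ∑ j, if π i = π j then 0 else G (π i) (π j) := by
          rw [sum_comm (s := (univ : Finset (Equiv.Perm (Fin n))))]
          exact sum_congr rfl fun i _ => sum_comm
      _ = ∑ _π : Equiv.Perm (Fin n), ∑ i, ∑ j, if i = j then 0 else G i j := by
          refine sum_congr rfl fun π _ => ?_
          rw [← Equiv.sum_comp π fun i => ∑ j, if i = j then 0 else G i j]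
          refine sum_congr rfl fun i _ => ?_
          rw [← Equiv.sum_comp π fun j => if π i = j then 0 else G (π i) j]
      _ = _ := by simp [Fintype.card_perm]
  have h₂ (i j : Fin n) (hij : i ≠ j) : ∑ π : Equiv.Perm (Fin n), G (π i) (π j) =
      ∑ π : Equiv.Perm (Fin n), G (π a) (π b) := by
    obtain ⟨ρ, rfl, rfl⟩ := exists_perm_apply_eq hab hij
    exact Equiv.sum_comp (Equiv.mulRight ρ) fun π : Equiv.Perm (Fin n) => G (π a) (π b)
  rw [← h₁]
  have h₃ : ∀ i j : Fin n, (if i = j then 0 else ∑ π : Equiv.Perm (Fin n), G (π i) (π j)) =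
      (1 - if i = j then 1 else 0) * ∑ π : Equiv.Perm (Fin n), G (π a) (π b) := fun i j => by
    by_cases h : i = j
    · simp [h]
    · simp [h, h₂ i j h]
  simp only [h₃, ← sum_mul]
  simp [sum_sub_distrib, mul_sub]

lemma uAvg_eq_avg_pairings {Ω : Type*} {m n : ℕ} (hn : 2 ≤ n)
    (e : Fin m × Bool ≃ Fin n) (f : Ω × Ω → ℝ) (S : Fin n → Ω) :
    (m : ℝ) * uAvg f S = ∑ π : Equiv.Perm (Fin n), (n.factorial : ℝ)⁻¹ *
      ∑ a, f (S (orderedPairing e π (a, false)), S (orderedPairing e π (a, true))) := by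
  set G : Fin n → Fin n → ℝ := fun i j => if i < j then f (S i, S j) else f (S j, S i) with hG
  have h₁ (π : Equiv.Perm (Fin n)) (a : Fin m) :
      f (S (orderedPairing e π (a, false)), S (orderedPairing e π (a, true))) =
        G (π (e (a, false))) (π (e (a, true))) := by
    by_cases h : π (e (a, false)) < π (e (a, true)) <;> simp [orderedPairing, hG, h]
  have hn' : (n : ℝ) * (n - 1) ≠ 0 := by
    have : (2 : ℝ) ≤ n := by exact_mod_cast hn
    exact mul_ne_zero (by linarith) (by linarith)
  have h₂ (a : Fin m) : (n.factorial : ℝ)⁻¹ * ∑ π : Equiv.Perm (Fin n),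
      G (π (e (a, false))) (π (e (a, true))) = uAvg f S := by
    have h := sum_perm_eq G (a := e (a, false)) (b := e (a, true)) (by simp)
    have hsum : ∑ i, ∑ j, (if i = j then 0 else G i j) =
        2 * ∑ i, ∑ j, if i < j then f (S i, S j) else 0 := by
      have : ∀ i j, (if i = j then 0 else G i j) =
          (if i < j then f (S i, S j) else 0) + if j < i then f (S j, S i) else 0 := by
        intro i j
        rcases lt_trichotomy i j with h | h | h
        · simp [h, h.ne, h.not_gt, hG]
        · simp [h]
        · simp [h, h.ne', h.not_gt, hG]
      simp only [this, sum_add_distrib, two_mul]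
      congr 1
      rw [sum_comm]
    rw [hsum] at h
    have hfac : (n.factorial : ℝ) ≠ 0 := by positivity
    rw [uAvg, inv_mul_eq_iff_eq_mul₀ hfac, ← mul_right_inj' hn', h, div_mul_eq_mul_div]
    rw [mul_left_comm ((n : ℝ) * (n - 1)) (n.factorial : ℝ), mul_div_cancel₀ _ hn']
  simp only [h₁]
  rw [← mul_sum, sum_comm, mul_sum]
  simp [h₂]

/-- Exponential moments of an average of functions of identically distributed maps. -/
lemma integral_exp_avg_le {Ω Ω' Ξ : Type*} [MeasurableSpace Ω] [MeasurableSpace Ω'] [Fintype Ξ]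
    {P : Measure Ω} [IsProbabilityMeasure P] {P' : Measure Ω'} {g : Ξ → Ω → Ω'}
    (hg : ∀ ξ, MeasurePreserving (g ξ) P P') {F : Ω' → ℝ} (hF : Measurable F)
    (hb : ∃ C, ∀ x, |F x| ≤ C) {w : ℝ} (hw : 0 ≤ w) (hw1 : Fintype.card Ξ * w = 1) :
    ∫ x, Real.exp (∑ ξ, w * F (g ξ x)) ∂P ≤ ∫ y, Real.exp (F y) ∂P' := by
  have hgm (ξ : Ξ) : Measurable (g ξ) := (hg ξ).measurable
  obtain ⟨C, hC⟩ := hb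
  have hi (ξ : Ξ) : Integrable (fun x => w * Real.exp (F (g ξ x))) P :=
    (integrable_exp_of_bounded (hF.comp (hgm ξ)) ⟨C, fun x => hC _⟩).const_mul w
  calc _ ≤ ∫ x, ∑ ξ, w * Real.exp (F (g ξ x)) ∂P := by
        refine integral_mono (integrable_exp_of_bounded (by fun_prop)
          ⟨∑ _ξ : Ξ, w * C, fun x => (abs_sum_le_sum_abs _ _).trans (sum_le_sum fun ξ _ => ?_)⟩)
          (integrable_finsetSum _ fun ξ _ => hi ξ) fun x => ?_
        · rw [abs_mul, abs_of_nonneg hw]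
          exact mul_le_mul_of_nonneg_left (hC _) hw
        · simpa using convexOn_exp.map_sum_le (t := univ) (w := fun _ : Ξ => w)
            (p := fun ξ => F (g ξ x)) (fun _ _ => hw) (by simpa using hw1) (fun _ _ => Set.mem_univ _)
    _ = ∑ _ξ : Ξ, w * ∫ y, Real.exp (F y) ∂P' := by
        rw [integral_finsetSum _ fun ξ _ => hi ξ]
        refine sum_congr rfl fun ξ _ => ?_
        rw [integral_const_mul, integral_comp_of_measurePreserving (hg ξ) hF.exp]
    _ = _ := by simp [← mul_assoc, hw1]

/-- McDiarmid's inequality for the supremum of one-sided deviations of pair averages, via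
averaging over pairings of the sample. -/
lemma measure_exists_dev_le {Ω Θ : Type*} [MeasurableSpace Ω] [Finite Θ] [Nonempty Θ]
    (D : Measure Ω) [IsProbabilityMeasure D] {f : Θ → Ω × Ω → ℝ} (hf : ∀ θ, Measurable (f θ))
    {lo M : ℝ} (hM : 0 < M) (hlo : ∀ θ x, lo ≤ f θ x) (hhi : ∀ θ x, f θ x ≤ lo + M)
    {m n : ℕ} (hn : 2 ≤ n) (hm : 0 < m) (e : Fin m × Bool ≃ Fin n) {r t : ℝ} (ht : 0 ≤ t)
    (hr : ∫ X, ⨆ θ, (m * ∫ x, f θ x ∂(D.prod D) - ∑ a, f θ (X a))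
      ∂(Measure.pi fun _ : Fin m => D.prod D) ≤ m * r) :
    (Measure.pi fun _ : Fin n => D)
        {S | ∃ θ, r + t < ∫ x, f θ x ∂(D.prod D) - uAvg (f θ) S} ≤
      ENNReal.ofReal (Real.exp (-(2 * m * t ^ 2 / M ^ 2))) := by
  have hC := abs_le_of_range hlo hhi
  set P : Measure (Fin n → Ω) := Measure.pi fun _ => D with hP
  set s : ℝ := 4 * t / M ^ 2 with hs
  have hs0 : 0 ≤ s := by positivity
  set E : Θ → ℝ := fun θ => ∫ x, f θ x ∂(D.prod D) with hE
  set F : (Fin m → Ω × Ω) → ℝ := fun X => ⨆ θ, (m * E θ - ∑ a, f θ (X a)) with hF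
  set W : Equiv.Perm (Fin n) → (Fin n → Ω) → Fin m → Ω × Ω := fun π S a =>
    (S (orderedPairing e π (a, false)), S (orderedPairing e π (a, true))) with hW
  set w : ℝ := (n.factorial : ℝ)⁻¹ with hw
  have hw0 : 0 ≤ w := by positivity
  have hcw : (Fintype.card (Equiv.Perm (Fin n)) : ℝ) * w = 1 := by
    rw [Fintype.card_perm, Fintype.card_fin, hw]
    exact mul_inv_cancel₀ (by positivity)
  have hWmp (π : Equiv.Perm (Fin n)) : MeasurePreserving (W π) P
      (Measure.pi fun _ : Fin m => D.prod D) := measurePreserving_pairs D (orderedPairing e π)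
  have hWm (π : Equiv.Perm (Fin n)) : Measurable (W π) := (hWmp π).measurable
  have hFm : Measurable F := by fun_prop
  have hFb (X : Fin m → Ω × Ω) : |F X| ≤ (⨆ θ, |(m : ℝ) * E θ|) + m * (|lo| + |lo + M|) := by
    refine abs_iSup_le_of_finite fun θ => (abs_sub _ _).trans ?_
    refine add_le_add (finite_le_ciSup (fun θ => |(m : ℝ) * E θ|) θ) ?_
    refine (abs_sum_le_sum_abs _ _).trans ((sum_le_sum fun a _ => hC θ (X a)).trans_eq ?_)
    simp [mul_add]
  have hFd (X : Fin m → Ω × Ω) (i : Fin m) (x : Ω × Ω) :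
      F X ≤ F (Function.update X i x) + M := by
    refine ciSup_le fun θ => ?_
    have h := finite_le_ciSup
      (fun θ => m * E θ - ∑ a, f θ (Function.update X i x a)) θ
    have h₁ := add_sum_erase univ (fun a => f θ (X a)) (mem_univ i)
    have h₂ := add_sum_erase univ (fun a => f θ (Function.update X i x a)) (mem_univ i)
    have h₃ : ∑ a ∈ univ.erase i, f θ (Function.update X i x a) =
        ∑ a ∈ univ.erase i, f θ (X a) :=
      sum_congr rfl fun a ha => by rw [Function.update_of_ne (ne_of_mem_erase ha)]
    simp only [Function.update_self] at h₂
    linarith [hlo θ (X i), hhi θ x]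
  set H : (Fin n → Ω) → ℝ := fun S => ∑ π, w * F (W π S) with hH
  have hHm : Measurable H := by fun_prop
  have hsub : {S | ∃ θ, r + t < E θ - uAvg (f θ) S} ⊆ {S | m * (r + t) ≤ H S} := by
    rintro S ⟨θ, hθ⟩
    have h₁ : m * (E θ - uAvg (f θ) S) ≤ H S := by
      have : m * (E θ - uAvg (f θ) S) = ∑ π, w * (m * E θ - ∑ a, f θ (W π S a)) := by
        simp only [mul_sub, sum_sub_distrib]
        rw [uAvg_eq_avg_pairings hn e, sum_const, card_univ, nsmul_eq_mul, ← mul_assoc, hcw,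
          one_mul]
      rw [this]
      exact sum_le_sum fun π _ => mul_le_mul_of_nonneg_left
        (finite_le_ciSup (fun θ => m * E θ - ∑ a, f θ (W π S a)) θ) hw0
    exact (mul_le_mul_of_nonneg_left hθ.le (Nat.cast_nonneg m)).trans h₁
  have hexp : (fun S => Real.exp (s * H S)) = fun S => Real.exp (∑ π, w * (s * F (W π S))) := by
    ext S; simp only [hH, mul_sum, mul_left_comm s]
  have hsFb : ∀ X, |s * F X| ≤ s * ((⨆ θ, |(m : ℝ) * E θ|) + m * (|lo| + |lo + M|)) := fun X => by
    rw [abs_mul, abs_of_nonneg hs0]; exact mul_le_mul_of_nonneg_left (hFb X) hs0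
  have hmgf : mgf H P s ≤ Real.exp (s * (m * r) + m * ((s * M) ^ 2 / 8)) := by
    rw [mgf, hexp]
    refine (integral_exp_avg_le hWmp (hFm.const_mul s) ⟨_, hsFb⟩ hw0 hcw).trans ?_
    refine (integral_exp_le_of_bounded_differences (D.prod D) (hFm.const_mul s) ⟨_, hsFb⟩
      (c := s * M) fun X i x => ?_).trans ?_
    · rw [← mul_add]; exact mul_le_mul_of_nonneg_left (hFd X i x) hs0
    · rw [integral_const_mul]
      gcongr
  have hint : Integrable (fun S => Real.exp (s * H S)) P := by
    refine integrable_exp_of_bounded (hHm.const_mul s)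
      ⟨∑ _π : Equiv.Perm (Fin n),
        w * (s * ((⨆ θ, |(m : ℝ) * E θ|) + m * (|lo| + |lo + M|))), fun S => ?_⟩
    simp only [hH, mul_sum, mul_left_comm s]
    refine (abs_sum_le_sum_abs _ _).trans (sum_le_sum fun π _ => ?_)
    rw [abs_mul, abs_of_nonneg hw0]
    exact mul_le_mul_of_nonneg_left (hsFb _) hw0
  have hch := measure_ge_le_exp_mul_mgf (μ := P) (X := H) (m * (r + t)) hs0 hint
  refine (measure_mono hsub).trans ?_
  rw [← ENNReal.ofReal_toReal (measure_ne_top P _)]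
  refine ENNReal.ofReal_le_ofReal (hch.trans ?_)
  refine (mul_le_mul_of_nonneg_left hmgf (Real.exp_pos _).le).trans_eq ?_
  rw [← Real.exp_add]
  congr 1
  rw [hs]
  field_simp
  ring

lemma hinge_eq {X : Type*} {p : ℕ} (K : Fin p → X → X → ℝ) (μ : Fin p → ℝ) (w w' : X × Bool) :
    hinge K μ w w' = max 0 (1 - ip μ fun i => sgn w.2 * sgn w'.2 * K i w.1 w'.1) := by
  simp only [hinge, ip, zmap, mul_sum, mul_left_comm]

lemma abs_sgn_mul_sgn_mul (b b' : Bool) (x : ℝ) : |sgn b * sgn b' * x| = |x| := by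
  rw [abs_mul, abs_mul, abs_sgn, abs_sgn, one_mul, one_mul]

lemma hinge_nonneg {X : Type*} {p : ℕ} (K : Fin p → X → X → ℝ) (μ : Fin p → ℝ)
    (w w' : X × Bool) : 0 ≤ hinge K μ w w' := le_max_left _ _

lemma hinge_le {X : Type*} {p : ℕ} {K : Fin p → X → X → ℝ} {c : ℝ}
    (hK : ∀ i x x', |K i x x'| ≤ c) (μ : Fin p → ℝ) (w w' : X × Bool) :
    hinge K μ w w' ≤ 1 + l1norm μ * c := by
  have h : |ip μ fun i => sgn w.2 * sgn w'.2 * K i w.1 w'.1| ≤ l1norm μ * c := by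
    rw [ip, l1norm, sum_mul]
    refine (abs_sum_le_sum_abs _ _).trans (sum_le_sum fun i _ => ?_)
    rw [abs_mul, abs_sgn_mul_sgn_mul]
    exact mul_le_mul_of_nonneg_left (hK _ _ _) (abs_nonneg _)
  rw [hinge_eq]
  have := abs_le.1 h
  exact max_le (by linarith [abs_nonneg (ip μ fun i => sgn w.2 * sgn w'.2 * K i w.1 w'.1)])
    (by linarith)

lemma measurable_hinge {X : Type*} [MeasurableSpace X] {p : ℕ} {K : Fin p → X → X → ℝ}
    (hK : ∀ i, Measurable fun w : X × X => K i w.1 w.2) (μ : Fin p → ℝ) :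
    Measurable fun w : (X × Bool) × (X × Bool) => hinge K μ w.1 w.2 := by
  have hs : Measurable sgn := measurable_of_countable _
  have hK' (i : Fin p) : Measurable fun w : (X × Bool) × (X × Bool) => K i w.1.1 w.2.1 :=
    (hK i).comp (by fun_prop : Measurable fun w : (X × Bool) × (X × Bool) => (w.1.1, w.2.1))
  unfold hinge ip zmap
  fun_prop

lemma empRisk_eq_uAvg {X : Type*} {p n : ℕ} (K : Fin p → X → X → ℝ) (S : Fin n → X × Bool)
    (μ : Fin p → ℝ) : empRisk K S μ = uAvg (fun w => hinge K μ w.1 w.2) S := rfl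

lemma l1norm_of_nonneg {p : ℕ} {μ : Fin p → ℝ} (hμ : ∀ i, 0 ≤ μ i) : l1norm μ = ∑ i, μ i :=
  sum_congr rfl fun i _ => abs_of_nonneg (hμ i)

lemma l1norm_nonneg {p : ℕ} (μ : Fin p → ℝ) : 0 ≤ l1norm μ := sum_nonneg fun _ _ => abs_nonneg _

lemma sqrt_add_sqrt_le {x y : ℝ} (hx : 0 ≤ x) (hy : 0 ≤ y) :
    Real.sqrt x + Real.sqrt y ≤ Real.sqrt (2 * (x + y)) := by
  refine Real.le_sqrt_of_sq_le ?_
  nlinarith [Real.sq_sqrt hx, Real.sq_sqrt hy, sq_nonneg (Real.sqrt x - Real.sqrt y)]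

/-- One-sided deviation of the empirical risk of a single vector. -/
lemma measure_empRisk_dev_le {X : Type*} [MeasurableSpace X] {p m n : ℕ}
    {K : Fin p → X → X → ℝ} (hKm : ∀ i, Measurable fun w : X × X => K i w.1 w.2) {c : ℝ}
    (hc : 0 < c) (hK : ∀ i x x', |K i x x'| ≤ c) (D : Measure (X × Bool)) [IsProbabilityMeasure D]
    (hn : 2 ≤ n) (hm : 0 < m) (e : Fin m × Bool ≃ Fin n) (μ : Fin p → ℝ) {L : ℝ} (hL : 0 ≤ L) :
    (Measure.pi fun _ : Fin n => D)
        {S | (1 + l1norm μ * c) * Real.sqrt (L / m) < empRisk K S μ - trueRisk K D μ} ≤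
      ENNReal.ofReal (Real.exp (-(2 * L))) := by
  set M := 1 + l1norm μ * c with hM
  have hM0 : 0 < M := by have := mul_nonneg (l1norm_nonneg μ) hc.le; linarith
  set f : Unit → (X × Bool) × (X × Bool) → ℝ := fun _ w => -hinge K μ w.1 w.2 with hf
  have hfm : ∀ θ, Measurable (f θ) := fun _ => (measurable_hinge hKm μ).neg
  have hlo : ∀ θ x, -M ≤ f θ x := fun _ x => neg_le_neg (hinge_le hK μ _ _)
  have hhi : ∀ θ x, f θ x ≤ -M + M := fun _ x => by
    rw [neg_add_cancel]; exact neg_nonpos.2 (hinge_nonneg K μ _ _)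
  have hC := abs_le_of_range hlo hhi
  have hi (a : Fin m) : Integrable (fun X : Fin m → (X × Bool) × (X × Bool) => f () (X a))
      (Measure.pi fun _ => D.prod D) :=
    integrable_of_bounded ((hfm ()).comp (measurable_pi_apply a)) ⟨_, fun X => hC () _⟩
  have hE (a : Fin m) : ∫ X : Fin m → (X × Bool) × (X × Bool), f () (X a)
      ∂(Measure.pi fun _ => D.prod D) = ∫ x, f () x ∂(D.prod D) :=
    integral_comp_of_measurePreserving (measurePreserving_eval (fun _ => D.prod D) a) (hfm ())
  have hr : ∫ X, ⨆ θ, (m * ∫ x, f θ x ∂(D.prod D) - ∑ a, f θ (X a))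
      ∂(Measure.pi fun _ : Fin m => D.prod D) ≤ m * 0 := by
    simp only [ciSup_unique, PUnit.default_eq_unit, mul_zero]
    rw [integral_sub (integrable_const _) (integrable_finsetSum _ fun a _ => hi a),
      integral_finsetSum _ fun a _ => hi a]
    simp [hE]
  have h := measure_exists_dev_le D hfm hM0 hlo hhi hn hm e
    (t := M * Real.sqrt (L / m)) (by positivity) hr
  refine (measure_mono ?_).trans (h.trans_eq ?_)
  · intro S hS
    refine ⟨(), ?_⟩
    have h₁ : ∫ x, f () x ∂(D.prod D) = -trueRisk K D μ := by
      rw [trueRisk, ← integral_neg]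
    have h₂ : uAvg (f ()) S = -empRisk K S μ := by
      rw [empRisk_eq_uAvg, uAvg, uAvg, ← mul_neg, ← sum_neg_distrib]
      refine congrArg _ (sum_congr rfl fun i _ => ?_)
      rw [← sum_neg_distrib]
      refine sum_congr rfl fun j _ => ?_
      split_ifs <;> simp [hf]
    rw [h₁, h₂]
    have : M * Real.sqrt (L / m) < empRisk K S μ - trueRisk K D μ := hS
    linarith
  · congr 3
    rw [mul_pow, Real.sq_sqrt (by positivity)]
    have : (m : ℝ) ≠ 0 := by positivity
    field_simp

lemma measure_exists_hinge_dev_le_of_finite {X Θ : Type*} [MeasurableSpace X] [Finite Θ]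
    [Nonempty Θ] {p m n : ℕ} (hp : 3 ≤ p)
    {K : Fin p → X → X → ℝ} (hKm : ∀ i, Measurable fun w : X × X => K i w.1 w.2) {c : ℝ}
    (hc : 0 < c) (hK : ∀ i x x', |K i x x'| ≤ c) (D : Measure (X × Bool)) [IsProbabilityMeasure D]
    (hn : 2 ≤ n) (hm : 0 < m) (e : Fin m × Bool ≃ Fin n) {μ : Θ → Fin p → ℝ}
    (hμ : ∀ θ i, 0 ≤ μ θ i) {B : ℝ} (hB0 : 0 ≤ B) (hB : ∀ θ, l1norm (μ θ) ≤ B) {L : ℝ}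
    (hL : 1 / 4 ≤ L) :
    (Measure.pi fun _ : Fin n => D)
        {S | ∃ θ, 2 * B * c * Real.sqrt (Real.log p / m) + (1 + B * c) * Real.sqrt (L / m) <
          trueRisk K D (μ θ) - empRisk K S (μ θ)} ≤
      ENNReal.ofReal (Real.exp (1 / 4 - L)) := by
  set M := 1 + B * c with hM
  have hM0 : 0 < M := by positivity
  have hm0 : (0 : ℝ) < m := by exact_mod_cast hm
  set f : Θ → (X × Bool) × (X × Bool) → ℝ := fun θ w => hinge K (μ θ) w.1 w.2 with hf
  have hfm : ∀ θ, Measurable (f θ) := fun θ => measurable_hinge hKm (μ θ)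
  have hlo : ∀ θ x, 0 ≤ f θ x := fun θ x => hinge_nonneg K _ _ _
  have hhi : ∀ θ x, f θ x ≤ 0 + M := fun θ x => by
    have := hinge_le hK (μ θ) x.1 x.2
    have := mul_le_mul_of_nonneg_right (hB θ) hc.le
    simp only [hf]; linarith
  have hR := integral_iSup_dev_le (D.prod D) hfm hM0.le hlo hhi (m := m) fun Z => by
    have h := hinge_rademacher_le hp (N := m + m) (by omega)
      (fun i j => sgn (Z i).1.2 * sgn (Z i).2.2 * K j (Z i).1.1 (Z i).2.1) c hc
      (fun i j => by rw [abs_sgn_mul_sgn_mul]; exact hK _ _ _) μ hμ B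
      (fun θ => (l1norm_of_nonneg (hμ θ)).symm.trans_le (hB θ))
    simpa only [hf, hinge_eq] using h
  set r := 2 * B * c * Real.sqrt (Real.log p / m) + M * Real.sqrt (1 / (8 * m)) with hr
  have hsq (x : ℝ) : m * Real.sqrt (x / m) = Real.sqrt (x * m) := by
    rw [← Real.sqrt_sq hm0.le, ← Real.sqrt_mul (sq_nonneg _), Real.sqrt_sq hm0.le]
    congr 1; field_simp
  have hr' : B * (c * Real.sqrt (2 * ((m + m : ℕ) : ℝ) * Real.log p)) +
      M / 4 * Real.sqrt (m + m) = m * r := by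
    have h₁ : Real.sqrt (2 * ((m + m : ℕ) : ℝ) * Real.log p) =
        2 * (m * Real.sqrt (Real.log p / m)) := by
      rw [hsq, show 2 * ((m + m : ℕ) : ℝ) * Real.log p = 2 ^ 2 * (Real.log p * m) by
        push_cast; ring, Real.sqrt_mul (by norm_num), Real.sqrt_sq (by norm_num)]
    have h₂ : Real.sqrt (m + m) = 4 * (m * Real.sqrt (1 / (8 * m))) := by
      rw [show (1 : ℝ) / (8 * m) = (1 / 8) / m by field_simp, hsq,
        show (m : ℝ) + m = 4 ^ 2 * (1 / 8 * m) by ring, Real.sqrt_mul (by norm_num),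
        Real.sqrt_sq (by norm_num)]
    rw [h₁, h₂, hr]; ring
  have h := measure_exists_dev_le D hfm hM0 hlo hhi hn hm e (r := r)
    (t := M * Real.sqrt ((L - 1 / 4) / (2 * m))) (by positivity) (hR.trans_eq hr')
  refine (measure_mono fun S hS => ?_).trans (h.trans_eq ?_)
  · obtain ⟨θ, hθ⟩ := hS
    refine ⟨θ, lt_of_le_of_lt ?_ hθ⟩
    have hs := sqrt_add_sqrt_le (x := 1 / (8 * (m : ℝ))) (y := (L - 1 / 4) / (2 * m))
      (by positivity) (div_nonneg (by linarith) (by positivity))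
    rw [show 2 * (1 / (8 * (m : ℝ)) + (L - 1 / 4) / (2 * m)) = L / m by field_simp; ring] at hs
    rw [hr, add_assoc, ← mul_add]
    gcongr
  · congr 2
    rw [mul_pow, Real.sq_sqrt (div_nonneg (by linarith) (by positivity))]
    field_simp
    ring

lemma measure_exists_hinge_dev_le {X : Type*} [MeasurableSpace X] {p m n : ℕ} (hp : 3 ≤ p)
    {K : Fin p → X → X → ℝ} (hKm : ∀ i, Measurable fun w : X × X => K i w.1 w.2) {c : ℝ}
    (hc : 0 < c) (hK : ∀ i x x', |K i x x'| ≤ c) (D : Measure (X × Bool)) [IsProbabilityMeasure D]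
    (hn : 2 ≤ n) (hm : 0 < m) (e : Fin m × Bool ≃ Fin n) {B : ℝ} (hB0 : 0 ≤ B) {L : ℝ}
    (hL : 1 / 4 ≤ L) :
    (Measure.pi fun _ : Fin n => D)
        {S | ∃ μ : Fin p → ℝ, ((∀ i, 0 ≤ μ i) ∧ l1norm μ ≤ B) ∧
          2 * B * c * Real.sqrt (Real.log p / m) + (1 + B * c) * Real.sqrt (L / m) <
            trueRisk K D μ - empRisk K S μ} ≤
      ENNReal.ofReal (Real.exp (1 / 4 - L)) := by
  set thr := 2 * B * c * Real.sqrt (Real.log p / m) + (1 + B * c) * Real.sqrt (L / m)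
  let C := {μ : Fin p → ℝ // (∀ i, 0 ≤ μ i) ∧ l1norm μ ≤ B}
  have hne : Nonempty C := ⟨⟨0, by simp, by simpa [l1norm] using hB0⟩⟩
  have hcont (w : (X × Bool) × (X × Bool)) : Continuous fun μ : C => hinge K μ.1 w.1 w.2 := by
    exact continuous_const.max (continuous_const.sub (continuous_const.mul
      (continuous_finsetSum _ fun i _ =>
        ((continuous_apply i).comp continuous_subtype_val).mul continuous_const)))
  have hT : Continuous fun μ : C => trueRisk K D μ.1 := by
    refine continuous_of_dominated (bound := fun _ => 1 + B * c)
      (fun μ => (measurable_hinge hKm μ.1).aestronglyMeasurable)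
      (fun μ => ae_of_all _ fun w => ?_) (integrable_const _) (ae_of_all _ hcont)
    rw [Real.norm_of_nonneg (hinge_nonneg _ _ _ _)]
    have := hinge_le hK μ.1 w.1 w.2
    have := mul_le_mul_of_nonneg_right μ.2.2 hc.le
    linarith
  have hE (S : Fin n → X × Bool) : Continuous fun μ : C => empRisk K S μ.1 := by
    unfold empRisk
    refine continuous_const.mul (continuous_finsetSum _ fun i _ =>
      continuous_finsetSum _ fun j _ => ?_)
    split_ifs
    · exact hcont (S i, S j)
    · exact continuous_const
  set A : ℕ → Set (Fin n → X × Bool) := fun k => {S | ∃ j : Fin (k + 1),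
    thr < trueRisk K D (TopologicalSpace.denseSeq C j).1 -
      empRisk K S (TopologicalSpace.denseSeq C j).1} with hA
  have hmono : Monotone A := fun k l hkl S ⟨j, hj⟩ =>
    ⟨Fin.castLE (by omega) j, by simpa using hj⟩
  refine (measure_mono (t := ⋃ k, A k) ?_).trans ?_
  · rintro S ⟨μ, hμ, hlt⟩
    obtain ⟨_, hj, j, rfl⟩ := (TopologicalSpace.denseRange_denseSeq C).inter_open_nonempty
      _ (isOpen_lt (continuous_const (y := thr)) (hT.sub (hE S))) ⟨⟨μ, hμ⟩, hlt⟩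
    exact Set.mem_iUnion.2 ⟨j, Fin.last j, by simpa using hj⟩
  · rw [hmono.measure_iUnion]
    refine iSup_le fun k => measure_exists_hinge_dev_le_of_finite hp hKm hc hK D hn hm e
      (μ := fun j : Fin (k + 1) => (TopologicalSpace.denseSeq C j).1)
      (fun j => (TopologicalSpace.denseSeq C j).2.1) hB0
      (fun j => (TopologicalSpace.denseSeq C j).2.2) hL

lemma uAvg_nonneg {Ω : Type*} {n : ℕ} (hn : 2 ≤ n) {f : Ω × Ω → ℝ} (hf : ∀ w, 0 ≤ f w)
    (S : Fin n → Ω) : 0 ≤ uAvg f S := by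
  have : (2 : ℝ) ≤ n := by exact_mod_cast hn
  refine mul_nonneg (div_nonneg zero_le_two (mul_nonneg (by linarith) (by linarith)))
    (sum_nonneg fun i _ => sum_nonneg fun j _ => ?_)
  split_ifs
  exacts [hf _, le_rfl]

lemma empRisk_zero {X : Type*} {p m n : ℕ} (K : Fin p → X → X → ℝ) (S : Fin n → X × Bool)
    (hn : 2 ≤ n) (hm : 0 < m) (e : Fin m × Bool ≃ Fin n) : empRisk K S 0 = 1 := by
  have h := uAvg_eq_avg_pairings hn e (fun w => hinge K 0 w.1 w.2) S
  have hm' : (m : ℝ) ≠ 0 := by positivity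
  have hfac : (n.factorial : ℝ) ≠ 0 := by positivity
  rw [← mul_right_inj' hm', empRisk_eq_uAvg, h]
  simp [hinge, ip, Fintype.card_perm, hfac]

lemma minimizer_l1norm_le {X : Type*} {p m n : ℕ} {K : Fin p → X → X → ℝ} {S : Fin n → X × Bool}
    (hn : 2 ≤ n) (hm : 0 < m) (e : Fin m × Bool ≃ Fin n) {lam : ℝ} (hlam : 0 < lam)
    {muh : Fin p → ℝ}
    (h : lam / 2 * l1norm muh + empRisk K S muh ≤
      lam / 2 * l1norm (0 : Fin p → ℝ) + empRisk K S 0) : l1norm muh ≤ 2 / lam := by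
  have h₀ : l1norm (0 : Fin p → ℝ) = 0 := by simp [l1norm]
  have h₁ : 0 ≤ empRisk K S muh := uAvg_nonneg hn (fun w => hinge_nonneg K muh w.1 w.2) S
  rw [h₀, empRisk_zero K S hn hm e] at h
  rw [le_div_iff₀ hlam]
  linarith

/-- oracle-type bound for the L1-regularized empirical risk minimizer
against an ε_o-combination-good vector μ_o. -/
theorem stmt15 {X : Type*} [MeasurableSpace X] {p n : ℕ} (hp : 3 ≤ p)
    (hn : 2 ≤ n) (hev : Even n)
    (K : Fin p → X → X → ℝ)
    (hKm : ∀ i, Measurable (fun w : X × X => K i w.1 w.2))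
    (κ : Fin p → ℝ) (hκ : ∀ i, 0 < κ i)
    (hKb : ∀ i x x', |K i x x'| ≤ κ i ^ 2)
    (D : Measure (X × Bool)) [IsProbabilityMeasure D]
    (lam : ℝ) (hlam : 0 < lam) (δ : ℝ) (hδ0 : 0 < δ) (hδ1 : δ < 1)
    (μo : Fin p → ℝ) (hμo : ∀ i, 0 ≤ μo i) (εo : ℝ) (hgood : trueRisk K D μo ≤ εo) :
    ENNReal.ofReal (1 - 2 * δ) ≤
      (Measure.pi fun _ : Fin n => D) {S | ∀ muh : Fin p → ℝ, (∀ i, 0 ≤ muh i) →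
        (∀ μ : Fin p → ℝ, (∀ i, 0 ≤ μ i) →
          lam / 2 * l1norm muh + empRisk K S muh ≤
            lam / 2 * l1norm μ + empRisk K S μ) →
        trueRisk K D muh ≤ εo + lam / 2 * l1norm μo +
          2 * l1norm μo * linfnorm (fun i => κ i ^ 2) * Real.sqrt (2 * Real.log p / n) +
          (1 + l1norm μo * linfnorm (fun i => κ i ^ 2)) *
            Real.sqrt (2 * Real.log (1 / δ) / n) +
          (4 * linfnorm (fun i => κ i ^ 2) / lam) * Real.sqrt (2 * Real.log p / n) +
          (1 + 2 * linfnorm (fun i => κ i ^ 2) / lam) *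
            Real.sqrt (2 * Real.log (1 / δ) / n)} := by
  obtain ⟨m, rfl⟩ := hev
  have hm : 0 < m := by omega
  rcases le_or_gt (1 / 2) δ with hδ | hδ
  · rw [ENNReal.ofReal_of_nonpos (by linarith)]; exact bot_le
  set P : Measure (Fin (m + m) → X × Bool) := Measure.pi fun _ => D
  set c := linfnorm fun i => κ i ^ 2 with hc_def
  set L := Real.log (1 / δ) with hL_def
  have hκc (i : Fin p) : κ i ^ 2 ≤ c :=
    (le_abs_self _).trans (finite_le_ciSup (fun i => |κ i ^ 2|) i)
  have hc : 0 < c := (pow_pos (hκ ⟨0, by omega⟩) 2).trans_le (hκc _)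
  have hK : ∀ i x x', |K i x x'| ≤ c := fun i x x' => (hKb i x x').trans (hκc i)
  have hL : 1 / 4 ≤ L := by
    have := Real.one_sub_inv_le_log_of_pos (one_div_pos.2 hδ0)
    rw [one_div, inv_inv, ← one_div] at this
    linarith
  have hexpL : Real.exp (-L) = δ := by
    rw [hL_def, one_div, Real.log_inv, neg_neg, Real.exp_log hδ0]
  have hdiv (x : ℝ) : 2 * x / ((m + m : ℕ) : ℝ) = x / m := by
    push_cast; rw [← two_mul, mul_div_mul_left _ _ two_ne_zero]
  rw [hdiv, hdiv]
  let e : Fin m × Bool ≃ Fin (m + m) := Fintype.equivOfCardEq (by simp; ring)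
  set B := 2 / lam with hB_def
  have hB0 : 0 ≤ B := by positivity
  have h₁ := measure_empRisk_dev_le hKm hc hK D hn hm e μo (L := L) (by linarith)
  have h₂ := measure_exists_hinge_dev_le hp hKm hc hK D hn hm e hB0 hL
  have hle : Real.exp (-(2 * L)) + Real.exp (1 / 4 - L) ≤ 2 * δ := by
    rw [show -(2 * L) = -L + -L by ring, sub_eq_add_neg, Real.exp_add, Real.exp_add, hexpL]
    have := Real.exp_bound_div_one_sub_of_interval (x := 1 / 4) (by norm_num) (by norm_num)
    nlinarith
  rw [ENNReal.ofReal_sub _ (by linarith), ENNReal.ofReal_one, tsub_le_iff_right,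
    ← measure_univ (μ := P)]
  refine (measure_mono fun S _ => ?_).trans ((measure_union_le _ _).trans
    (add_le_add_right ((measure_union_le _ _).trans ((add_le_add h₁ h₂).trans ?_)) _))
  · by_contra hS
    simp only [Set.mem_union, Set.mem_ofPred_eq, not_or, not_lt] at hS
    obtain ⟨hbad, hS₁, hS₂⟩ := hS
    refine hbad fun muh hmuh hmin => ?_
    have hnorm : l1norm muh ≤ B := minimizer_l1norm_le hn hm e hlam (hmin 0 fun _ => le_rfl)
    have hdev := not_lt.1 fun hlt => hS₂ ⟨muh, ⟨hmuh, hnorm⟩, hlt⟩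
    have ho := hmin μo hμo
    have hpos : 0 ≤ lam / 2 * l1norm muh := mul_nonneg (by positivity) (l1norm_nonneg _)
    have hextra : 0 ≤ 2 * l1norm μo * c * Real.sqrt (Real.log p / m) := by
      have := l1norm_nonneg μo
      positivity
    rw [show 4 * c / lam = 2 * B * c by rw [hB_def]; ring,
      show 2 * c / lam = B * c by rw [hB_def]; ring]
    linarith
  · rw [← ENNReal.ofReal_add (Real.exp_pos _).le (Real.exp_pos _).le]
    exact ENNReal.ofReal_le_ofReal hle
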